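/- Let V be an irreducible representation of G over k and let W be a nonzero proper H-subrepresentation of the restriction V|_H. Then V is isomorphic as a G-representation to the induced representation Ind_H^G W. -/

import Mathlib

variable {k : Type*} [Field k] {G : Type*} [Group G] (H : Subgroup G)

/-- The underlying space of the induced representation `Ind_H^G σ = k[G] ⊗_{k[H]} W`
(`H` of finite index): functions `f : G → W` with `f (x * h) = σ h⁻¹ (f x)` for `h ∈ H`.
For a finite-index subgroup this function model realizes the induced representation. -/
def indSupport {W : Type*} [AddCommGroup W] [Module k W]
    (σ : Representation k H W) : Submodule k (G → W) where
  carrier := {f | ∀ (h : H) (x : G), f (x * (h : G)) = σ h⁻¹ (f x)}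
  add_mem' := by
    intro a b ha hb h x
    simp only [Pi.add_apply, ha h x, hb h x, map_add]
  zero_mem' := by
    intro h x
    simp
  smul_mem' := by
    intro c f hf h x
    simp only [Pi.smul_apply, hf h x, map_smul]

/-- The action of `g : G` on the induced representation, by right translation. -/
def indAct {W : Type*} [AddCommGroup W] [Module k W]
    (σ : Representation k H W) (g : G) :
    indSupport H σ →ₗ[k] indSupport H σ where
  toFun f := ⟨fun x => (f : G → W) (g⁻¹ * x), by
    intro h x
    simpa [mul_assoc] using f.2 h (g⁻¹ * x)⟩
  map_add' f₁ f₂ := rfl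
  map_smul' c f := rfl

/-- The induced representation `Ind_H^G σ` of `σ : Representation k H W`. -/
def indRep {W : Type*} [AddCommGroup W] [Module k W]
    (σ : Representation k H W) : Representation k G ↥(indSupport H σ) where
  toFun := indAct H σ
  map_one' := by
    ext f x
    simp [indAct]
  map_mul' g₁ g₂ := by
    ext f x
    simp [indAct, mul_assoc]

/-- The representation of `H` on an `H`-stable subspace `W` of a representation `ρ`
of `G`: the restriction `ρ|_H` acting on `W`. -/
def resRep {V : Type*} [AddCommGroup V] [Module k V]
    (ρ : Representation k G V) (W : Submodule k V)
    (hstab : ∀ h ∈ H, ∀ v ∈ W, ρ h v ∈ W) : Representation k H ↥W where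
  toFun h := (ρ (h : G)).restrict (fun v hv => hstab h h.2 v hv)
  map_one' := by
    ext v
    simp [LinearMap.restrict_apply]
  map_mul' h₁ h₂ := by
    ext v
    simp [LinearMap.restrict_apply]

section IndexTwo

variable {H} {V : Type*} [AddCommGroup V] [Module k V] {ρ : Representation k G V}
  {W : Submodule k V} {s : G}

lemma map_rho_mem_map_of_notMem (hH : H.index = 2) (hs : s ∉ H)
    (hstab : ∀ h ∈ H, ∀ v ∈ W, ρ h v ∈ W) {g : G} (hg : g ∉ H) {w : V} (hw : w ∈ W) :
    ρ g w ∈ W.map (ρ s) := by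
  refine ⟨ρ (s⁻¹ * g) w, hstab _ ?_ w hw, ?_⟩
  · rw [Subgroup.mul_mem_iff_of_index_two hH, inv_mem_iff]
    tauto
  · rw [← Module.End.mul_apply, ← map_mul, mul_inv_cancel_left]

lemma map_rho_map_mem_map_of_mem (hH : H.index = 2) (hs : s ∉ H)
    (hstab : ∀ h ∈ H, ∀ v ∈ W, ρ h v ∈ W) {g : G} (hg : g ∈ H) {v : V} (hv : v ∈ W.map (ρ s)) :
    ρ g v ∈ W.map (ρ s) := by
  obtain ⟨w, hw, rfl⟩ := hv
  rw [← Module.End.mul_apply, ← map_mul]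
  refine map_rho_mem_map_of_notMem hH hs hstab ?_ hw
  rw [Subgroup.mul_mem_iff_of_index_two hH]
  tauto

lemma map_rho_map_mem_of_notMem (hH : H.index = 2) (hs : s ∉ H)
    (hstab : ∀ h ∈ H, ∀ v ∈ W, ρ h v ∈ W) {g : G} (hg : g ∉ H) {v : V} (hv : v ∈ W.map (ρ s)) :
    ρ g v ∈ W := by
  obtain ⟨w, hw, rfl⟩ := hv
  rw [← Module.End.mul_apply, ← map_mul]
  refine hstab _ ?_ w hw
  rw [Subgroup.mul_mem_iff_of_index_two hH]
  tauto

/-- An irreducible representation of `G` is the direct sum of a nonzero proper subspace `W` stable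
under an index two subgroup and of the translate of `W` by any element outside the subgroup. -/
lemma isCompl_map_rho_of_index_two (hH : H.index = 2) (hs : s ∉ H)
    (hirr : ∀ U : Submodule k V, (∀ g : G, ∀ v ∈ U, ρ g v ∈ U) → U = ⊥ ∨ U = ⊤)
    (hW0 : W ≠ ⊥) (hWt : W ≠ ⊤) (hstab : ∀ h ∈ H, ∀ v ∈ W, ρ h v ∈ W) :
    IsCompl W (W.map (ρ s)) := by
  constructor
  · rw [disjoint_iff]
    refine (hirr _ ?_).resolve_right fun h => hWt (top_le_iff.1 (h ▸ inf_le_left))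
    rintro g v ⟨hv, hv'⟩
    by_cases hg : g ∈ H
    · exact ⟨hstab g hg v hv, map_rho_map_mem_map_of_mem hH hs hstab hg hv'⟩
    · exact ⟨map_rho_map_mem_of_notMem hH hs hstab hg hv',
        map_rho_mem_map_of_notMem hH hs hstab hg hv⟩
  · rw [codisjoint_iff]
    refine (hirr _ ?_).resolve_left fun h => hW0 (le_bot_iff.1 (h ▸ le_sup_left))
    intro g v hv
    obtain ⟨a, ha, b, hb, rfl⟩ := Submodule.mem_sup.1 hv
    rw [map_add]
    by_cases hg : g ∈ H
    · exact add_mem (Submodule.mem_sup_left (hstab g hg a ha))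
        (Submodule.mem_sup_right (map_rho_map_mem_map_of_mem hH hs hstab hg hb))
    · exact add_mem (Submodule.mem_sup_right (map_rho_mem_map_of_notMem hH hs hstab hg ha))
        (Submodule.mem_sup_left (map_rho_map_mem_of_notMem hH hs hstab hg hb))

/-- For `f` in the representation induced from `W`, the vector `ρ x (f x)` depends only on the
coset `x H`. -/
lemma rho_indSupport_apply_eq {hstab : ∀ h ∈ H, ∀ v ∈ W, ρ h v ∈ W}
    (f : indSupport H (resRep H ρ W hstab)) {x y : G} (hxy : x⁻¹ * y ∈ H) :
    ρ y ((f : G → W) y) = ρ x ((f : G → W) x) := by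
  have h : (((f : G → W) (x * (x⁻¹ * y)) : W) : V) = ρ (x⁻¹ * y)⁻¹ ((f : G → W) x) :=
    congrArg Subtype.val (f.2 ⟨x⁻¹ * y, hxy⟩ x)
  rw [mul_inv_cancel_left] at h
  rw [h, ← Module.End.mul_apply, ← map_mul]
  simp

/-- The map `f ↦ f 1 + ρ s (f s)` from the representation induced from `W` to the ambient one. -/
def indEval (ρ : Representation k G V) (W : Submodule k V)
    (hstab : ∀ h ∈ H, ∀ v ∈ W, ρ h v ∈ W) (s : G) :
    indSupport H (resRep H ρ W hstab) →ₗ[k] V where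
  toFun f := (f : G → W) 1 + ρ s ((f : G → W) s)
  map_add' f₁ f₂ := by
    simp only [Submodule.coe_add, Pi.add_apply, map_add]
    abel
  map_smul' c f := by
    simp only [Submodule.coe_smul, Pi.smul_apply, map_smul, smul_add, RingHom.id_apply]

lemma indEval_indRep (hH : H.index = 2) (hs : s ∉ H) (hstab : ∀ h ∈ H, ∀ v ∈ W, ρ h v ∈ W) (g : G)
    (f : indSupport H (resRep H ρ W hstab)) :
    indEval ρ W hstab s (indRep H (resRep H ρ W hstab) g f) = ρ g (indEval ρ W hstab s f) := by
  have key (x : G) : (((f : G → W) (g⁻¹ * x) : W) : V) =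
      ρ x⁻¹ (ρ g (ρ (g⁻¹ * x) ((f : G → W) (g⁻¹ * x)))) := by
    simp only [← Module.End.mul_apply, ← map_mul]
    simp
  have h1 : (1 : G) ∈ H := H.one_mem
  change (((f : G → W) (g⁻¹ * 1) : W) : V) + ρ s ((f : G → W) (g⁻¹ * s)) =
    ρ g ((f : G → W) 1 + ρ s ((f : G → W) s))
  rw [key 1, key s, Representation.self_inv_apply, inv_one, map_one, Module.End.one_apply,
    ← map_add]
  congr 1
  by_cases hg : g ∈ H
  · rw [rho_indSupport_apply_eq f (x := 1) (y := g⁻¹ * 1),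
      rho_indSupport_apply_eq f (x := s) (y := g⁻¹ * s), map_one, Module.End.one_apply]
    all_goals simp only [Subgroup.mul_mem_iff_of_index_two hH, inv_mem_iff]; tauto
  · rw [rho_indSupport_apply_eq f (x := s) (y := g⁻¹ * 1),
      rho_indSupport_apply_eq f (x := 1) (y := g⁻¹ * s), map_one, Module.End.one_apply, add_comm]
    all_goals simp only [Subgroup.mul_mem_iff_of_index_two hH, inv_mem_iff]; tauto

lemma indEval_injective (hH : H.index = 2) (hs : s ∉ H) (hstab : ∀ h ∈ H, ∀ v ∈ W, ρ h v ∈ W)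
    (hdisj : Disjoint W (W.map (ρ s))) : Function.Injective (indEval ρ W hstab s) := by
  rw [injective_iff_map_eq_zero]
  intro f hf
  change (((f : G → W) 1 : W) : V) + ρ s ((f : G → W) s) = 0 at hf
  have h1 : (((f : G → W) 1 : W) : V) = 0 := by
    refine Submodule.disjoint_def.1 hdisj _ ((f : G → W) 1).2 ?_
    rw [eq_neg_of_add_eq_zero_left hf]
    exact neg_mem (Submodule.mem_map_of_mem ((f : G → W) s).2)
  rw [h1, zero_add] at hf
  ext x
  change (((f : G → W) x : W) : V) = 0
  apply (ρ.apply_bijective x).injective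
  rw [map_zero]
  by_cases hx : x ∈ H
  · rw [rho_indSupport_apply_eq f (x := 1) (by simpa using hx), h1, map_zero]
  · rw [rho_indSupport_apply_eq f (x := s), hf]
    simp only [Subgroup.mul_mem_iff_of_index_two hH, inv_mem_iff]
    tauto

open scoped Classical in
lemma indEval_surjective (hH : H.index = 2) (hs : s ∉ H) (hstab : ∀ h ∈ H, ∀ v ∈ W, ρ h v ∈ W)
    (hcod : Codisjoint W (W.map (ρ s))) : Function.Surjective (indEval ρ W hstab s) := by
  intro v
  obtain ⟨a, ha, _, ⟨b, hb, rfl⟩, rfl⟩ := Submodule.mem_sup.1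
    (codisjoint_iff.1 hcod ▸ Submodule.mem_top : v ∈ W ⊔ W.map (ρ s))
  have hmem {x : G} (hx : x ∉ H) : x⁻¹ * s ∈ H := by
    rw [Subgroup.mul_mem_iff_of_index_two hH, inv_mem_iff]
    tauto
  refine ⟨⟨fun x => if hx : x ∈ H then ⟨ρ x⁻¹ a, hstab _ (inv_mem hx) a ha⟩
    else ⟨ρ (x⁻¹ * s) b, hstab _ (hmem hx) b hb⟩, fun h x => ?_⟩, ?_⟩
  · have hxh : x * h ∈ H ↔ x ∈ H := Subgroup.mul_mem_cancel_right H h.2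
    ext
    by_cases hx : x ∈ H <;> simp [hx, hxh, resRep, mul_assoc]
  · change ((dite _ _ _ : W) : V) + ρ s ((dite _ _ _ : W) : V) = _
    simp [hs, H.one_mem]

end IndexTwo

/-- Let `V` be an irreducible representation of `G` over `k`, `H` a normal
subgroup of index 2, and `W` a nonzero proper `H`-subrepresentation of `V|_H`. Then `V`
is isomorphic as a `G`-representation to the induced representation `Ind_H^G W`. -/
theorem statement1 [H.Normal] (hH : H.index = 2)
    {V : Type*} [AddCommGroup V] [Module k V]
    (ρ : Representation k G V)
    (hirr : Nontrivial V ∧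
      ∀ U : Submodule k V, (∀ g : G, ∀ v ∈ U, ρ g v ∈ U) → U = ⊥ ∨ U = ⊤)
    (W : Submodule k V) (hW0 : W ≠ ⊥) (hWt : W ≠ ⊤)
    (hstab : ∀ h ∈ H, ∀ v ∈ W, ρ h v ∈ W) :
    ∃ e : V ≃ₗ[k] ↥(indSupport H (resRep H ρ W hstab)),
      ∀ (g : G) (v : V), e (ρ g v) = indRep H (resRep H ρ W hstab) g (e v) := by
  obtain ⟨s, hs⟩ : ∃ s, s ∉ H := by
    by_contra! h
    simp [(Subgroup.eq_top_iff' H).2 h] at hH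
  have hc := isCompl_map_rho_of_index_two hH hs hirr.2 hW0 hWt hstab
  let e := LinearEquiv.ofBijective (indEval ρ W hstab s)
    ⟨indEval_injective hH hs hstab hc.disjoint, indEval_surjective hH hs hstab hc.codisjoint⟩
  refine ⟨e.symm, fun g v => ?_⟩
  rw [LinearEquiv.symm_apply_eq]
  exact ((indEval_indRep hH hs hstab g _).trans (congrArg (ρ g) (e.apply_symm_apply v))).symm
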